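/- Let r(t) = a₁t² + a₂t + a₃ be a planar quadratic parametric curve with a₁ × a₂ ≠ 0 and signed curvature κ. Then the curvature variation over the whole real line equals V = ∫_ℝ κ̇(t)² dt = (45π/16) · |a₁|⁸ / |a₁ × a₂|⁵. -/

import Mathlib

open Real MeasureTheory

open Filter Topology in
lemma integral_sq_div_one_add_sq_pow_five :
    ∫ u : ℝ, u ^ 2 / (1 + u ^ 2) ^ 5 = 5 * π / 128 := by
  set G : ℝ → ℝ := fun v => v / (1 + v ^ 2) *
    (5 / 128 + 5 / 192 * (v ^ 2 / (1 + v ^ 2)) + 1 / 48 * (v ^ 2 / (1 + v ^ 2)) ^ 2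
      - 1 / 8 * (v ^ 2 / (1 + v ^ 2)) ^ 3) with hG
  have hG0 : Tendsto G (𝓝 0) (𝓝 0) := by
    have hc : ContinuousAt G 0 := by
      have : ∀ v : ℝ, 1 + v ^ 2 ≠ 0 := fun v => by positivity
      exact Continuous.continuousAt (by fun_prop (disch := assumption))
    simpa [ContinuousAt, hG] using hc
  set F : ℝ → ℝ := fun u => 5 / 128 * arctan u + (5 / 128 * (u / (1 + u ^ 2))
    + 5 / 192 * (u / (1 + u ^ 2) ^ 2) + 1 / 48 * (u / (1 + u ^ 2) ^ 3)
    - 1 / 8 * (u / (1 + u ^ 2) ^ 4)) with hF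
  have hFG : F = fun u => 5 / 128 * arctan u + G u⁻¹ := by
    funext u
    rcases eq_or_ne u 0 with rfl | hu
    · simp [hF, hG]
    · simp only [hF, hG]
      have h1 : u⁻¹ / (1 + u⁻¹ ^ 2) = u / (1 + u ^ 2) := by
        field_simp
        ring
      have h2 : u⁻¹ ^ 2 / (1 + u⁻¹ ^ 2) = 1 / (1 + u ^ 2) := by
        field_simp
        ring
      rw [h1, h2]
      field_simp
  have hderiv : ∀ u : ℝ, HasDerivAt F (u ^ 2 / (1 + u ^ 2) ^ 5) u := by
    intro u
    have hw : (1 + u ^ 2) ≠ 0 := by positivity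
    have hd : HasDerivAt (fun u : ℝ => 1 + u ^ 2) (2 * u) u := by
      simpa using (hasDerivAt_pow 2 u).const_add 1
    have hk : ∀ k : ℕ, HasDerivAt (fun u : ℝ => u / (1 + u ^ 2) ^ k) _ u := fun k =>
      (hasDerivAt_id u).div (hd.pow k) (pow_ne_zero k hw)
    have h1 := (hasDerivAt_id u).div hd hw
    have := ((hasDerivAt_arctan u).const_mul (5 / 128)).add
      ((((h1.const_mul (5 / 128)).add ((hk 2).const_mul (5 / 192))).add
        ((hk 3).const_mul (1 / 48))).sub ((hk 4).const_mul (1 / 8)))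
    refine this.congr_deriv ?_
    simp
    field_simp
    ring
  have hint : Integrable (fun u : ℝ => u ^ 2 / (1 + u ^ 2) ^ 5) := by
    refine integrable_inv_one_add_sq.mono' ?_ (.of_forall fun u => ?_)
    · have : ∀ v : ℝ, (1 + v ^ 2) ^ 5 ≠ 0 := fun v => by positivity
      exact Continuous.aestronglyMeasurable (by fun_prop (disch := assumption))
    · rw [Real.norm_of_nonneg (by positivity), div_le_iff₀ (by positivity)]
      have h1 : 1 ≤ 1 + u ^ 2 := by nlinarith [sq_nonneg u]
      have h4 : (1 + u ^ 2)⁻¹ * (1 + u ^ 2) ^ 5 = (1 + u ^ 2) ^ 4 := by field_simp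
      rw [h4]
      have := le_self_pow₀ h1 (n := 4) (by norm_num)
      linarith
  have htop : Tendsto F atTop (𝓝 (5 / 128 * (π / 2) + 0)) := by
    rw [hFG]
    exact ((tendsto_arctan_atTop.mono_right nhdsWithin_le_nhds).const_mul _).add
      (hG0.comp tendsto_inv_atTop_zero)
  have hbot : Tendsto F atBot (𝓝 (5 / 128 * (-(π / 2)) + 0)) := by
    rw [hFG]
    exact ((tendsto_arctan_atBot.mono_right nhdsWithin_le_nhds).const_mul _).add
      (hG0.comp tendsto_inv_atBot_zero)
  rw [integral_of_hasDerivAt_of_tendsto hderiv hint hbot htop]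
  ring

lemma sq_deriv_mul_rpow_neg_three_halves {Q : ℝ → ℝ} {q t : ℝ} (c : ℝ) (hQ : HasDerivAt Q q t)
    (hpos : 0 < Q t) :
    (deriv (fun s => c / Q s ^ ((3 : ℝ) / 2)) t) ^ 2 = 9 / 4 * c ^ 2 * q ^ 2 / Q t ^ 5 := by
  have h := ((hQ.rpow_const (p := 3 / 2) (Or.inl hpos.ne')).fun_inv
    (rpow_pos_of_pos hpos _).ne').const_mul c
  simp only [← div_eq_mul_inv] at h
  have h1 : (Q t ^ ((3 : ℝ) / 2 - 1)) ^ 2 = Q t := by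
    rw [← rpow_natCast, ← rpow_mul hpos.le]
    norm_num
  have h2 : (Q t ^ ((3 : ℝ) / 2)) ^ 2 = Q t ^ 3 := by
    rw [← rpow_natCast, ← rpow_mul hpos.le, ← rpow_natCast]
    norm_num
  rw [h.deriv]
  have h3 : (c * (-(q * (3 / 2) * Q t ^ ((3 : ℝ) / 2 - 1)) / (Q t ^ ((3 : ℝ) / 2)) ^ 2)) ^ 2
      = 9 / 4 * c ^ 2 * q ^ 2 * (Q t ^ ((3 : ℝ) / 2 - 1)) ^ 2
        / ((Q t ^ ((3 : ℝ) / 2)) ^ 2) ^ 2 := by ring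
  rw [h3, h1, h2]
  field_simp

lemma hasDerivAt_quadratic (a b c t : ℝ) :
    HasDerivAt (fun t => a * t ^ 2 + b * t + c) (2 * a * t + b) t := by
  have := (((hasDerivAt_pow 2 t).const_mul a).add ((hasDerivAt_id t).const_mul b)).add_const c
  refine this.congr_deriv ?_
  simp
  ring

lemma deriv_quadratic (a b c : ℝ) :
    deriv (fun t => a * t ^ 2 + b * t + c) = fun t => 2 * a * t + b :=
  funext fun t => (hasDerivAt_quadratic a b c t).deriv

lemma deriv_affine (a b : ℝ) : deriv (fun t => a * t + b) = fun _ => a := by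
  funext t
  simp

/-- For a planar quadratic parametric curve `r(t) = a₁ t² + a₂ t + a₃` with
`a₁ = (x₁, y₁)`, `a₂ = (x₂, y₂)`, `a₃ = (x₃, y₃)` and `a₁ × a₂ ≠ 0`, the
curvature variation over the whole real line equals
`(45π/16) · |a₁|⁸ / |a₁ × a₂|⁵`, where `|a₁|` is the Euclidean norm. -/
theorem curvature_variation_of_quadratic
    (x₁ y₁ x₂ y₂ x₃ y₃ : ℝ)
    (x y : ℝ → ℝ)
    (hx : x = fun t => x₁ * t ^ 2 + x₂ * t + x₃)
    (hy : y = fun t => y₁ * t ^ 2 + y₂ * t + y₃)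
    (hcross : x₁ * y₂ - y₁ * x₂ ≠ 0)
    (κ : ℝ → ℝ)
    (hκ : κ = fun t =>
      (deriv x t * deriv (deriv y) t - deriv y t * deriv (deriv x) t) /
        ((deriv x t) ^ 2 + (deriv y t) ^ 2) ^ ((3 : ℝ) / 2)) :
    ∫ t : ℝ, (deriv κ t) ^ 2 =
      (45 * π / 16) * (Real.sqrt (x₁ ^ 2 + y₁ ^ 2)) ^ 8 / |x₁ * y₂ - y₁ * x₂| ^ 5 := by
  set A := x₁ ^ 2 + y₁ ^ 2 with hA
  set B := x₁ * x₂ + y₁ * y₂ with hB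
  set C := |x₁ * y₂ - y₁ * x₂| with hC
  have hC0 : 0 < C := abs_pos.mpr hcross
  have hC2 : C ^ 2 = (x₁ * y₂ - y₁ * x₂) ^ 2 := sq_abs _
  have hA0 : 0 < A := by
    refine lt_of_le_of_ne (by positivity) fun h => hcross ?_
    have hx0 : x₁ = 0 := by nlinarith [sq_nonneg x₁, sq_nonneg y₁]
    have hy0 : y₁ = 0 := by nlinarith [sq_nonneg x₁, sq_nonneg y₁]
    simp [hx0, hy0]
  have hlagrange : A * (x₂ ^ 2 + y₂ ^ 2) = B ^ 2 + C ^ 2 := by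
    rw [hC2, hA, hB]
    ring
  set Q : ℝ → ℝ := fun t => 4 * A * t ^ 2 + 4 * B * t + (x₂ ^ 2 + y₂ ^ 2) with hQ
  have hκQ : κ = fun t => (-2 * (x₁ * y₂ - y₁ * x₂)) / Q t ^ ((3 : ℝ) / 2) := by
    rw [hκ, hx, hy]
    funext t
    simp only [deriv_quadratic, deriv_affine, hQ, hA, hB]
    congr 1
    · ring
    · congr 1
      ring
  have hQu : ∀ t, Q t = C ^ 2 / A * (1 + (2 * A / C * (t + B / (2 * A))) ^ 2) := by
    intro t
    have hD : x₂ ^ 2 + y₂ ^ 2 = (B ^ 2 + C ^ 2) / A := by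
      rw [← hlagrange]
      field_simp
    simp only [hQ]
    rw [hD]
    field_simp
    ring
  have hQpos : ∀ t, 0 < Q t := fun t => by
    rw [hQu]
    positivity
  have hsq : ∀ t, (deriv κ t) ^ 2 = 144 * A ^ 5 / C ^ 6 *
      ((fun u : ℝ => u ^ 2 / (1 + u ^ 2) ^ 5) (2 * A / C * (t + B / (2 * A)))) := by
    intro t
    rw [hκQ, sq_deriv_mul_rpow_neg_three_halves _
      (hasDerivAt_quadratic (4 * A) (4 * B) (x₂ ^ 2 + y₂ ^ 2) t) (hQpos t), mul_pow, ← hC2,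
      show 4 * A * t ^ 2 + 4 * B * t + (x₂ ^ 2 + y₂ ^ 2) = _ from hQu t]
    have hq : 2 * (4 * A) * t + 4 * B = 4 * C * (2 * A / C * (t + B / (2 * A))) := by
      field_simp
    rw [hq]
    generalize 2 * A / C * (t + B / (2 * A)) = u
    field_simp
    ring
  simp_rw [hsq]
  rw [integral_const_mul,
    integral_add_right_eq_self
      (fun t : ℝ => (fun u : ℝ => u ^ 2 / (1 + u ^ 2) ^ 5) (2 * A / C * t)),
    Measure.integral_comp_mul_left (fun u : ℝ => u ^ 2 / (1 + u ^ 2) ^ 5),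
    integral_sq_div_one_add_sq_pow_five, abs_of_pos (by positivity), smul_eq_mul]
  have hs : √A ^ 8 = A ^ 4 := by
    rw [show √A ^ 8 = (√A ^ 2) ^ 4 by ring, sq_sqrt hA0.le]
  rw [hs]
  field_simp
  ring
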